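/- Let G be a connected graph with a cut-edge v_1 v_2, and for i = 1, 2 let H_i be the connected component of G − v_1 v_2 containing v_i. For i = 1, 2, let G_i be the graph obtained from G by contracting the component H_i to the single vertex v_i (so G_1 consists of H_2 together with the pendant vertex v_1 joined to v_2, and G_2 consists of H_1 together with the pendant vertex v_2 joined to v_1). Then pc(G) = max{pc(G_1), pc(G_2)}. -/

import Mathlib

/-- A walk in an edge-colored graph is *proper* if no two consecutive edges share a color. -/
def ProperWalk {V : Type*} {G : SimpleGraph V} (c : Sym2 V → ℕ) {u v : V}
    (p : G.Walk u v) : Prop :=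
  p.edges.Chain' fun e f => c e ≠ c f

/-- `c` is a proper-path coloring of `G`: every pair of distinct vertices is joined by a
proper path. -/
def IsProperPathColoring {V : Type*} (G : SimpleGraph V) (c : Sym2 V → ℕ) : Prop :=
  ∀ u v : V, u ≠ v → ∃ p : G.Walk u v, p.IsPath ∧ ProperWalk c p

/-- The proper connection number: the least `k` such that some coloring of the edges with
colors `0, …, k-1` is a proper-path coloring. -/
noncomputable def pc {V : Type*} (G : SimpleGraph V) : ℕ :=
  sInf {k | ∃ c : Sym2 V → ℕ, (∀ e ∈ G.edgeSet, c e < k) ∧ IsProperPathColoring G c}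

/-- `G` has the strong property under `c`: any two distinct vertices are joined by two proper
paths whose first-edge colors differ and whose last-edge colors differ. -/
def HasStrongProperty {V : Type*} (G : SimpleGraph V) (c : Sym2 V → ℕ) : Prop :=
  ∀ u v : V, u ≠ v → ∃ p q : G.Walk u v, p.IsPath ∧ q.IsPath ∧
    ProperWalk c p ∧ ProperWalk c q ∧
    p.edges.head?.map c ≠ q.edges.head?.map c ∧
    p.edges.getLast?.map c ≠ q.edges.getLast?.map c

/-- `c` makes `G` 2-proper connected: any two distinct vertices are joined by two
internally vertex-disjoint proper paths. -/
def Is2ProperConnected {V : Type*} (G : SimpleGraph V) (c : Sym2 V → ℕ) : Prop :=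
  ∀ u v : V, u ≠ v → ∃ p q : G.Walk u v, p.IsPath ∧ q.IsPath ∧
    ProperWalk c p ∧ ProperWalk c q ∧ p ≠ q ∧
    ∀ x, x ∈ p.support → x ∈ q.support → x = u ∨ x = v

/-- The 2-proper connection number. -/
noncomputable def pc2 {V : Type*} (G : SimpleGraph V) : ℕ :=
  sInf {k | ∃ c : Sym2 V → ℕ, (∀ e ∈ G.edgeSet, c e < k) ∧ Is2ProperConnected G c}

open SimpleGraph

/-- Proper-path coloring relative to a vertex set, with everything living in the big graph. -/
def GoodOn {V : Type*} (G : SimpleGraph V) (S : Set V) (k : ℕ) (c : Sym2 V → ℕ) : Prop :=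
  (∀ x ∈ S, ∀ y ∈ S, G.Adj x y → c s(x, y) < k) ∧
  ∀ u ∈ S, ∀ v ∈ S, u ≠ v → ∃ p : G.Walk u v, p.IsPath ∧ ProperWalk c p ∧ ∀ x ∈ p.support, x ∈ S

theorem properWalk_iff_map {V : Type*} {G : SimpleGraph V} (c : Sym2 V → ℕ) {u v : V}
    (p : G.Walk u v) : ProperWalk c p ↔ (p.edges.map c).IsChain (· ≠ ·) := by
  rw [List.isChain_map]; rfl

theorem properWalk_map {V W : Type*} {G : SimpleGraph V} {H : SimpleGraph W} (f : G →g H)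
    (c : Sym2 W → ℕ) {u v : V} (p : G.Walk u v) :
    ProperWalk c (p.map f) ↔ ProperWalk (fun e => c (e.map f)) p := by
  rw [properWalk_iff_map, properWalk_iff_map, Walk.edges_map, List.map_map]
  rfl

theorem map_edges_congr {V : Type*} {G : SimpleGraph V} {c c' : Sym2 V → ℕ} {S : Set V}
    (h : ∀ x ∈ S, ∀ y ∈ S, G.Adj x y → c s(x, y) = c' s(x, y)) {u v : V}
    (p : G.Walk u v) (hp : ∀ x ∈ p.support, x ∈ S) : p.edges.map c = p.edges.map c' := by
  apply List.map_congr_left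
  intro e he
  induction e using Sym2.ind with
  | _ x y =>
    exact h x (hp x (p.fst_mem_support_of_mem_edges he)) y
      (hp y (p.snd_mem_support_of_mem_edges he)) (p.adj_of_mem_edges he)

theorem exists_induce_iff {V : Type*} (G : SimpleGraph V) (S : Set V) (k : ℕ) :
    (∃ c : Sym2 S → ℕ, (∀ e ∈ (G.induce S).edgeSet, c e < k) ∧
      IsProperPathColoring (G.induce S) c) ↔ ∃ c, GoodOn G S k c := by
  have hinj : Function.Injective (Sym2.map (Subtype.val : S → V)) :=
    Sym2.map.injective Subtype.val_injective
  constructor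
  · rintro ⟨c, hb, hc⟩
    refine ⟨Function.extend (Sym2.map (Subtype.val : S → V)) c 0, ?_, ?_⟩
    · intro x hx y hy hxy
      have := hinj.extend_apply c 0 s(⟨x, hx⟩, ⟨y, hy⟩)
      simp only [Sym2.map_mk] at this
      rw [this]
      exact hb _ (by simpa using hxy)
    · intro u hu v hv huv
      obtain ⟨p, hp, hpc⟩ := hc ⟨u, hu⟩ ⟨v, hv⟩ (by simpa using huv)
      refine ⟨p.map (Embedding.induce S).toHom, ?_, ?_, ?_⟩
      · exact hp.map (Embedding.induce (G := G) S).injective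
      · refine (properWalk_map (Embedding.induce S).toHom _ p).2 ?_
        have : (fun e => Function.extend (Sym2.map (Subtype.val : S → V)) c 0
            (e.map (Embedding.induce (G := G) S).toHom)) = c := by
          funext e
          exact hinj.extend_apply c 0 e
        rwa [this]
      · intro x hx
        replace hx := List.mem_map.1 ((Walk.support_map (Embedding.induce S).toHom p) ▸ hx)
        obtain ⟨y, -, rfl⟩ := hx
        exact y.2
  · rintro ⟨c, hb, hc⟩
    refine ⟨fun e => c (e.map Subtype.val), ?_, ?_⟩
    · intro e he
      induction e using Sym2.ind with
      | _ x y => exact hb x x.2 y y.2 (by simpa using he)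
    · rintro ⟨u, hu⟩ ⟨v, hv⟩ huv
      obtain ⟨p, hp, hpc, hs⟩ := hc u hu v hv (by simpa using huv)
      have hm := p.map_induce hs
      refine ⟨p.induce S hs, ?_, ?_⟩
      · rw [← hm] at hp
        exact hp.of_map
      · rw [← hm] at hpc
        exact (properWalk_map (Embedding.induce S).toHom _ _).1 hpc

theorem exists_univ_iff {V : Type*} (G : SimpleGraph V) (k : ℕ) :
    (∃ c : Sym2 V → ℕ, (∀ e ∈ G.edgeSet, c e < k) ∧
      IsProperPathColoring G c) ↔ ∃ c, GoodOn G Set.univ k c := by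
  refine exists_congr fun c => and_congr ?_ ?_
  · simp [Sym2.forall]
  · simp [IsProperPathColoring]

/-- a cut edge `a b` with sides `A`, `B`. -/
structure Cut {V : Type*} (G : SimpleGraph V) (A B : Set V) (a b : V) : Prop where
  cover : ∀ x, x ∈ A ∨ x ∈ B
  disj : ∀ x, x ∈ A → x ∉ B
  ha : a ∈ A
  hb : b ∈ B
  adj : G.Adj a b
  only : ∀ x ∈ A, ∀ y ∈ B, G.Adj x y → x = a ∧ y = b

theorem Cut.symm {V : Type*} {G : SimpleGraph V} {A B : Set V} {a b : V} (h : Cut G A B a b) :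
    Cut G B A b a :=
  ⟨fun x => (h.cover x).symm, fun x hB hA => h.disj x hA hB, h.hb, h.ha, h.adj.symm,
    fun x hx y hy hxy => (h.only y hy x hx hxy.symm).symm⟩

theorem Cut.mem_walk {V : Type*} {G : SimpleGraph V} {A B : Set V} {a b : V}
    (h : Cut G A B a b) {u x : V} (p : G.Walk u x) (hu : u ∈ B ∪ {a}) (hx : x ∉ B ∪ {a}) :
    a ∈ p.support := by
  obtain ⟨d, hd, h1, h2⟩ := p.exists_boundary_dart _ hu hx
  have h3 := p.dart_fst_mem_support_of_mem_darts hd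
  have h4 : d.snd ∉ B := fun h' => h2 (Or.inl h')
  have h5 := (h.cover d.snd).resolve_right h4
  rcases h1 with h1 | h1
  · exact absurd (Or.inr (h.only _ h5 _ h1 d.adj.symm).1) h2
  · rw [Set.mem_singleton_iff] at h1
    rwa [h1] at h3

theorem Cut.path_mem {V : Type*} [DecidableEq V] {G : SimpleGraph V} {A B : Set V} {a b : V}
    (h : Cut G A B a b) {u v : V} (p : G.Walk u v) (hp : p.IsPath) (hu : u ∈ B ∪ {a})
    (hv : v ∈ B ∪ {a}) : ∀ x ∈ p.support, x ∈ B ∪ {a} := by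
  intro x hx
  by_contra hxS
  have h1 := h.mem_walk (p.takeUntil x hx) hu hxS
  have h2 := h.mem_walk (p.dropUntil x hx).reverse hv hxS
  rw [Walk.support_reverse, List.mem_reverse] at h2
  have hs := p.take_spec hx
  rw [← hs, Walk.isPath_def, Walk.support_append] at hp
  rw [← Walk.cons_tail_support, List.mem_cons] at h2
  rcases h2 with h2 | h2
  · exact hxS (Or.inr h2.symm)
  · exact List.disjoint_of_nodup_append hp h1 h2

theorem Cut.restrict {V : Type*} [DecidableEq V] {G : SimpleGraph V} {A B : Set V} {a b : V}
    (h : Cut G A B a b) {k : ℕ} {c : Sym2 V → ℕ} (hc : GoodOn G Set.univ k c) :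
    GoodOn G (B ∪ {a}) k c := by
  refine ⟨fun x _ y _ => hc.1 x trivial y trivial, fun u hu v hv huv => ?_⟩
  obtain ⟨p, hp, hpc, -⟩ := hc.2 u trivial v trivial huv
  exact ⟨p, hp, hpc, h.path_mem p hp hu hv⟩

theorem Cut.half {V : Type*} {G : SimpleGraph V} {A B : Set V} {a b : V}
    (h : Cut G A B a b) {k : ℕ} {c : Sym2 V → ℕ} (hc : GoodOn G (B ∪ {a}) k c) {u : V}
    (hu : u ∈ B) : ∃ p : G.Walk b u, p.IsPath ∧ (∀ x ∈ p.support, x ∈ B) ∧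
      ((s(a, b) :: p.edges).map c).IsChain (· ≠ ·) := by
  obtain ⟨p, hp, hpc, hs⟩ := hc.2 a (Or.inr rfl) u (Or.inl hu) (fun e => h.disj a h.ha (e ▸ hu))
  cases p with
  | nil => exact absurd hu (h.disj _ h.ha)
  | @cons _ w _ haw q =>
    rw [Walk.cons_isPath_iff] at hp
    have hq : ∀ x ∈ q.support, x ∈ B := by
      intro x hx
      rcases hs x (by simp [hx]) with h1 | h1
      · exact h1
      · rw [Set.mem_singleton_iff] at h1
        exact absurd (h1 ▸ hx) hp.2
    obtain rfl := (h.only a h.ha w (hq w q.start_mem_support) haw).2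
    refine ⟨q, hp.1, hq, ?_⟩
    rw [properWalk_iff_map] at hpc
    simpa using hpc

theorem GoodOn.congr {V : Type*} {G : SimpleGraph V} {S : Set V} {k : ℕ} {c c' : Sym2 V → ℕ}
    (hc : GoodOn G S k c) (h : ∀ x ∈ S, ∀ y ∈ S, G.Adj x y → c s(x, y) = c' s(x, y)) :
    GoodOn G S k c' := by
  refine ⟨fun x hx y hy hxy => h x hx y hy hxy ▸ hc.1 x hx y hy hxy, fun u hu v hv huv => ?_⟩
  obtain ⟨p, hp, hpc, hs⟩ := hc.2 u hu v hv huv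
  refine ⟨p, hp, ?_, hs⟩
  rw [properWalk_iff_map] at hpc ⊢
  rwa [← map_edges_congr h p hs]

theorem GoodOn.perm {V : Type*} {G : SimpleGraph V} {S : Set V} {k : ℕ} {c : Sym2 V → ℕ}
    (hc : GoodOn G S k c) (f : ℕ ≃ ℕ) (hf : ∀ n < k, f n < k) :
    GoodOn G S k (fun e => f (c e)) := by
  refine ⟨fun x hx y hy hxy => hf _ (hc.1 x hx y hy hxy), fun u hu v hv huv => ?_⟩
  obtain ⟨p, hp, hpc, hs⟩ := hc.2 u hu v hv huv
  refine ⟨p, hp, ?_, hs⟩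
  unfold ProperWalk at hpc ⊢
  simpa using hpc

theorem Cut.join {V : Type*} {G : SimpleGraph V} {A B : Set V} {a b : V}
    (h : Cut G A B a b) {k : ℕ} {c : Sym2 V → ℕ} (h1 : GoodOn G (B ∪ {a}) k c)
    (h2 : GoodOn G (A ∪ {b}) k c) {u v : V} (hu : u ∈ B) (hv : v ∈ A) :
    ∃ p : G.Walk u v, p.IsPath ∧ ProperWalk c p := by
  obtain ⟨p, hp, hps, hpc⟩ := h.half h1 hu
  obtain ⟨q, hq, hqs, hqc⟩ := h.symm.half h2 hv
  refine ⟨p.reverse.append (Walk.cons h.adj.symm q), ?_, ?_⟩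
  · rw [Walk.isPath_def, Walk.support_append, List.nodup_append']
    refine ⟨hp.reverse.support_nodup, by simpa using hq.support_nodup, ?_⟩
    intro x hx hx'
    rw [Walk.support_reverse, List.mem_reverse] at hx
    exact h.disj x (hqs x (by simpa using hx')) (hps x hx)
  · rw [properWalk_iff_map]
    have e1 : (List.map c (p.reverse.append (Walk.cons h.adj.symm q)).edges) =
      (p.edges.map c).reverse ++ [c s(b, a)] ++ q.edges.map c := by
      simp [Walk.edges_append, Walk.edges_reverse]
    rw [e1]
    refine List.IsChain.append_overlap ?_ (by simpa using hqc) (by simp)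
    rw [← List.isChain_reverse]
    simpa [ne_comm, Sym2.eq_swap (a := b)] using hpc

theorem Cut.merge {V : Type*} {G : SimpleGraph V} {A B : Set V} {a b : V}
    (h : Cut G A B a b) {k : ℕ} {c₁ c₂ : Sym2 V → ℕ} (h1 : GoodOn G (B ∪ {a}) k c₁)
    (h2 : GoodOn G (A ∪ {b}) k c₂) : ∃ c, GoodOn G Set.univ k c := by
  classical
  have k1 : c₁ s(a, b) < k := h1.1 a (Or.inr rfl) b (Or.inl h.hb) h.adj
  have k2 : c₂ s(a, b) < k := h2.1 a (Or.inl h.ha) b (Or.inr rfl) h.adj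
  have h2' := h2.perm (Equiv.swap (c₂ s(a, b)) (c₁ s(a, b))) (by
    intro n hn
    rw [Equiv.swap_apply_def]
    split_ifs <;> assumption)
  set c : Sym2 V → ℕ := fun e => if ∀ x ∈ e, x ∈ B ∪ {a} then c₁ e else
    Equiv.swap (c₂ s(a, b)) (c₁ s(a, b)) (c₂ e) with hcdef
  have g1 : GoodOn G (B ∪ {a}) k c := by
    refine h1.congr fun x hx y hy _ => ?_
    rw [hcdef]
    simp only
    rw [if_pos]
    intro z hz
    rcases Sym2.mem_iff.1 hz with rfl | rfl <;> assumption
  have g2 : GoodOn G (A ∪ {b}) k c := by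
    refine h2'.congr fun x hx y hy hxy => ?_
    rw [hcdef]
    simp only
    split_ifs with hh
    · have key : ∀ z, z ∈ A ∪ {b} → z ∈ B ∪ {a} → z = a ∨ z = b := by
        rintro z (hz | hz) (hz' | hz')
        · exact absurd hz' (h.disj z hz)
        · exact Or.inl hz'
        · exact Or.inr hz
        · exact Or.inr hz
      have hx' := key x hx (hh x (by simp))
      have hy' := key y hy (hh y (by simp))
      have : s(x, y) = s(a, b) := by
        have := hxy.ne
        rcases hx' with rfl | rfl <;> rcases hy' with rfl | rfl
        · exact absurd rfl this
        · rfl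
        · exact Sym2.eq_swap
        · exact absurd rfl this
      rw [this, Equiv.swap_apply_left]
    · rfl
  refine ⟨c, ?_, ?_⟩
  · intro x _ y _ hxy
    rcases h.cover x with hx | hx <;> rcases h.cover y with hy | hy
    · exact g2.1 x (Or.inl hx) y (Or.inl hy) hxy
    · obtain ⟨rfl, rfl⟩ := h.only x hx y hy hxy
      exact g1.1 _ (Or.inr rfl) _ (Or.inl hy) hxy
    · obtain ⟨rfl, rfl⟩ := h.only y hy x hx hxy.symm
      exact g1.1 _ (Or.inl hx) _ (Or.inr rfl) hxy
    · exact g1.1 x (Or.inl hx) y (Or.inl hy) hxy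
  · intro u _ v _ huv
    rcases h.cover u with hx | hx <;> rcases h.cover v with hy | hy
    · obtain ⟨p, hp, hpc, -⟩ := g2.2 u (Or.inl hx) v (Or.inl hy) huv
      exact ⟨p, hp, hpc, fun _ _ => trivial⟩
    · obtain ⟨p, hp, hpc⟩ := h.symm.join g2 g1 hx hy
      exact ⟨p, hp, hpc, fun _ _ => trivial⟩
    · obtain ⟨p, hp, hpc⟩ := h.join g1 g2 hx hy
      exact ⟨p, hp, hpc, fun _ _ => trivial⟩
    · obtain ⟨p, hp, hpc, -⟩ := g1.2 u (Or.inl hx) v (Or.inl hy) huv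
      exact ⟨p, hp, hpc, fun _ _ => trivial⟩

theorem GoodOn.mono {V : Type*} {G : SimpleGraph V} {S : Set V} {k l : ℕ} {c : Sym2 V → ℕ}
    (hc : GoodOn G S k c) (hkl : k ≤ l) : GoodOn G S l c :=
  ⟨fun x hx y hy hxy => (hc.1 x hx y hy hxy).trans_le hkl, hc.2⟩

theorem exists_good {V : Type*} [Fintype V] [DecidableEq V] (G : SimpleGraph V)
    (hconn : G.Connected) : ∃ k c, GoodOn G Set.univ k c := by
  refine ⟨Fintype.card (Sym2 V), fun e => (Fintype.equivFin (Sym2 V) e : ℕ), ?_, ?_⟩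
  · intro x _ y _ _
    exact Fin.is_lt _
  · intro u _ v _ _
    obtain ⟨p, hp⟩ := hconn.exists_isPath u v
    refine ⟨p, hp, ?_, fun _ _ => trivial⟩
    have := hp.isTrail.edges_nodup
    refine (List.Pairwise.isChain this).imp ?_
    intro e f hef h
    exact hef ((Fintype.equivFin (Sym2 V)).injective (Fin.ext h))

theorem pc_eq_max_of_cut {V : Type*} [Fintype V] [DecidableEq V] (G : SimpleGraph V)
    (hconn : G.Connected) {A B : Set V} {a b : V} (h : Cut G A B a b) :
    pc G = max (pc (G.induce (B ∪ {a}))) (pc (G.induce (A ∪ {b}))) := by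
  unfold pc
  simp only [exists_induce_iff]
  rw [show {k | ∃ c : Sym2 V → ℕ, (∀ e ∈ G.edgeSet, c e < k) ∧ IsProperPathColoring G c} =
    {k | ∃ c, GoodOn G Set.univ k c} from Set.ext fun k => exists_univ_iff G k]
  obtain ⟨k, c, hc⟩ := exists_good G hconn
  have n0 : {k | ∃ c, GoodOn G Set.univ k c}.Nonempty := ⟨k, c, hc⟩
  have n1 : {k | ∃ c, GoodOn G (B ∪ {a}) k c}.Nonempty := ⟨k, c, h.restrict hc⟩
  have n2 : {k | ∃ c, GoodOn G (A ∪ {b}) k c}.Nonempty := ⟨k, c, h.symm.restrict hc⟩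
  apply le_antisymm
  · apply Nat.sInf_le
    obtain ⟨c1, h1⟩ := Nat.sInf_mem n1
    obtain ⟨c2, h2⟩ := Nat.sInf_mem n2
    exact h.merge (h1.mono (le_max_left _ _)) (h2.mono (le_max_right _ _))
  · obtain ⟨c, hc⟩ := Nat.sInf_mem n0
    exact max_le (Nat.sInf_le ⟨c, h.restrict hc⟩) (Nat.sInf_le ⟨c, h.symm.restrict hc⟩)

theorem cut_of_bridge {V : Type*} (G : SimpleGraph V)
    (hconn : G.Connected) (v₁ v₂ : V) (hbridge : G.IsBridge s(v₁, v₂)) :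
    Cut G {w : V | (G.deleteEdges {s(v₁, v₂)}).Reachable v₁ w}
      {w : V | (G.deleteEdges {s(v₁, v₂)}).Reachable v₂ w} v₁ v₂ := by
  have hadj : G.Adj v₁ v₂ := hbridge.reachable_iff_adj.1 (hconn.preconnected _ _)
  have hb := isBridge_iff.1 hbridge
  have step : ∀ x y, G.Adj x y → s(x, y) ≠ s(v₁, v₂) →
      (G.deleteEdges {s(v₁, v₂)}).Reachable x y := fun x y hxy hne =>
    Adj.reachable (by rw [deleteEdges_adj]; exact ⟨hxy, hne⟩)
  refine ⟨?_, ?_, Reachable.refl _, Reachable.refl _, hadj, ?_⟩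
  · intro x
    by_contra hx
    obtain ⟨p⟩ := hconn.preconnected v₁ x
    obtain ⟨d, -, h1, h2⟩ := p.exists_boundary_dart
      ({w : V | (G.deleteEdges {s(v₁, v₂)}).Reachable v₁ w} ∪
      {w : V | (G.deleteEdges {s(v₁, v₂)}).Reachable v₂ w}) (Or.inl (Reachable.refl _)) hx
    by_cases he : s(d.fst, d.snd) = s(v₁, v₂)
    · rcases Sym2.eq_iff.1 he with ⟨-, e⟩ | ⟨-, e⟩
      · exact h2 (Or.inr (by rw [e]; exact Reachable.refl _))
      · exact h2 (Or.inl (by rw [e]; exact Reachable.refl _))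
    · have := step _ _ d.adj he
      exact h2 (h1.imp (fun h => Reachable.trans h this) (fun h => Reachable.trans h this))
  · intro x hx hx'
    exact hb (Reachable.trans hx (Reachable.symm hx'))
  · intro x hx y hy hxy
    by_cases he : s(x, y) = s(v₁, v₂)
    · rcases Sym2.eq_iff.1 he with e | ⟨e1, e2⟩
      · exact e
      · subst e1
        exact absurd hx hb
    · exact absurd (Reachable.trans hx ((step _ _ hxy he).trans (Reachable.symm hy))) hb

theorem stmt5 {V : Type*} [Fintype V] [DecidableEq V] (G : SimpleGraph V)
    (hconn : G.Connected) (v₁ v₂ : V) (hbridge : G.IsBridge s(v₁, v₂)) :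
    pc G =
      max (pc (G.induce ({w : V | (G.deleteEdges {s(v₁, v₂)}).Reachable v₂ w} ∪ {v₁})))
          (pc (G.induce ({w : V | (G.deleteEdges {s(v₁, v₂)}).Reachable v₁ w} ∪ {v₂}))) := 
  pc_eq_max_of_cut G hconn (cut_of_bridge G hconn v₁ v₂ hbridge)
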